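/- Let δ ≥ 0 and let Q ∈ Sym₀ satisfy dist(Q, N) ≤ δ. Write Q = s·((n⊗n − (1/3)Id) + r·(m⊗m − (1/3)Id)) with s ≥ 0, r ∈ [0,1] and n, m orthonormal eigenvectors of Q (s = 2λ₁ + λ₂, r = (λ₁ + 2λ₂)/s for λ₁ ≥ λ₂ the two largest eigenvalues). Then |s − s*| ≤ √3·δ and s·r ≤ √3·δ, and consequently 1 − (2√3/s*)·δ ≤ φ(Q) ≤ 1 + (2√3/s*)·δ. -/

import Mathlib

open Matrix

noncomputable section

/-- The space `Sym₀` of symmetric traceless `3 × 3` real matrices (as a subset of matrices). -/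
def Sym0 : Set (Matrix (Fin 3) (Fin 3) ℝ) := {Q | Q.IsSymm ∧ Q.trace = 0}

/-- The norm `|Q| = √(tr Q²)`. -/
def nrm (Q : Matrix (Fin 3) (Fin 3) ℝ) : ℝ := Real.sqrt ((Q * Q).trace)

/-- The Landau-de Gennes bulk potential
`f(Q) = C - a/2 tr(Q²) - b/3 tr(Q³) + c/4 (tr(Q²))²`. -/
def fLdG (a b c C : ℝ) (Q : Matrix (Fin 3) (Fin 3) ℝ) : ℝ :=
  C - a / 2 * (Q * Q).trace - b / 3 * (Q * Q * Q).trace + c / 4 * ((Q * Q).trace) ^ 2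

/-- `s* = (b + √(b² + 24 a c))/(4c)`. -/
def sstar (a b c : ℝ) : ℝ := (b + Real.sqrt (b ^ 2 + 24 * a * c)) / (4 * c)

/-- The matrix `n ⊗ n` with entries `nᵢ nⱼ`. -/
def outer (n : Fin 3 → ℝ) : Matrix (Fin 3) (Fin 3) ℝ := Matrix.of fun i j => n i * n j

/-- `n` is a unit vector of `ℝ³`. -/
def unitVec (n : Fin 3 → ℝ) : Prop := n 0 ^ 2 + n 1 ^ 2 + n 2 ^ 2 = 1

/-- The uniaxial matrix `s (n ⊗ n - Id/3)`. -/
def uniax (s : ℝ) (n : Fin 3 → ℝ) : Matrix (Fin 3) (Fin 3) ℝ :=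
  s • (outer n - (1 / 3 : ℝ) • (1 : Matrix (Fin 3) (Fin 3) ℝ))

/-- The vacuum manifold `N = { s* (n ⊗ n - Id/3) : n ∈ S² }`. -/
def Nset (a b c : ℝ) : Set (Matrix (Fin 3) (Fin 3) ℝ) :=
  {Q | ∃ n : Fin 3 → ℝ, unitVec n ∧ Q = uniax (sstar a b c) n}

/-- The distance `dist(Q, N) = inf_{P ∈ N} |Q - P|` measured in the norm `|·| = √(tr(·²))`. -/
def distN (a b c : ℝ) (Q : Matrix (Fin 3) (Fin 3) ℝ) : ℝ :=
  sInf ((fun P => nrm (Q - P)) '' Nset a b c)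

/-- The largest eigenvalue `λ₁(Q)` of a symmetric matrix `Q`, characterized as the maximum of the
quadratic form `v ↦ vᵀ Q v` over unit vectors `v`. -/
def lam1 (Q : Matrix (Fin 3) (Fin 3) ℝ) : ℝ :=
  sSup {x : ℝ | ∃ v : Fin 3 → ℝ, v ⬝ᵥ v = 1 ∧ x = v ⬝ᵥ Q.mulVec v}

/-- The smallest eigenvalue `λ₃(Q)` of a symmetric matrix `Q`, characterized as the minimum of the
quadratic form `v ↦ vᵀ Q v` over unit vectors `v`. -/
def lam3 (Q : Matrix (Fin 3) (Fin 3) ℝ) : ℝ :=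
  sInf {x : ℝ | ∃ v : Fin 3 → ℝ, v ⬝ᵥ v = 1 ∧ x = v ⬝ᵥ Q.mulVec v}

/-- The middle eigenvalue `λ₂(Q) = tr Q - λ₁(Q) - λ₃(Q)` of a symmetric matrix `Q`. -/
def lam2 (Q : Matrix (Fin 3) (Fin 3) ℝ) : ℝ := Q.trace - lam1 Q - lam3 Q

lemma trace_sq_outer_combination (n m p : Fin 3 → ℝ) (α β γ d : ℝ)
    (A : Matrix (Fin 3) (Fin 3) ℝ)
    (hA : A = α • outer n + β • outer m + γ • outer p + d • (1 : Matrix (Fin 3) (Fin 3) ℝ)) :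
    (A * A).trace = α ^ 2 * (n ⬝ᵥ n) ^ 2 + β ^ 2 * (m ⬝ᵥ m) ^ 2 + γ ^ 2 * (p ⬝ᵥ p) ^ 2
      + 2 * α * β * (n ⬝ᵥ m) ^ 2 + 2 * α * γ * (n ⬝ᵥ p) ^ 2 + 2 * β * γ * (m ⬝ᵥ p) ^ 2
      + 2 * d * (α * (n ⬝ᵥ n) + β * (m ⬝ᵥ m) + γ * (p ⬝ᵥ p)) + 3 * d ^ 2 := by
  subst hA
  simp [Matrix.trace, Matrix.mul_apply, dotProduct, Fin.sum_univ_three, outer, Matrix.one_apply]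
  ring

/-- Bessel's inequality for an orthonormal pair in `ℝ³`. -/
lemma sq_dotProduct_add_sq_dotProduct_le_one {n m v : Fin 3 → ℝ}
    (hn : n ⬝ᵥ n = 1) (hm : m ⬝ᵥ m = 1) (hnm : n ⬝ᵥ m = 0) (hv : v ⬝ᵥ v = 1) :
    (n ⬝ᵥ v) ^ 2 + (m ⬝ᵥ v) ^ 2 ≤ 1 := by
  have h : 0 ≤ (v - (n ⬝ᵥ v) • n - (m ⬝ᵥ v) • m) ⬝ᵥ (v - (n ⬝ᵥ v) • n - (m ⬝ᵥ v) • m) :=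
    Finset.sum_nonneg fun i _ => mul_self_nonneg _
  simp only [sub_dotProduct, dotProduct_sub, smul_dotProduct, dotProduct_smul, smul_eq_mul,
    dotProduct_comm v, dotProduct_comm m n, hn, hm, hnm, hv] at h
  nlinarith

lemma sq_dotProduct_add_mul_sq_dotProduct_le_one {n m v : Fin 3 → ℝ} {r : ℝ} (hr1 : r ≤ 1)
    (hn : n ⬝ᵥ n = 1) (hm : m ⬝ᵥ m = 1) (hnm : n ⬝ᵥ m = 0) (hv : v ⬝ᵥ v = 1) :
    (n ⬝ᵥ v) ^ 2 + r * (m ⬝ᵥ v) ^ 2 ≤ 1 := by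
  nlinarith [sq_dotProduct_add_sq_dotProduct_le_one hn hm hnm hv,
    mul_nonneg (sub_nonneg.2 hr1) (sq_nonneg (m ⬝ᵥ v))]

/-- The matrix `s ((n ⊗ n - Id/3) + r (m ⊗ m - Id/3))`. -/
def biax (s r : ℝ) (n m : Fin 3 → ℝ) : Matrix (Fin 3) (Fin 3) ℝ :=
  s • ((outer n - (1 / 3 : ℝ) • (1 : Matrix (Fin 3) (Fin 3) ℝ)) +
    r • (outer m - (1 / 3 : ℝ) • (1 : Matrix (Fin 3) (Fin 3) ℝ)))

lemma dotProduct_biax_mulVec (s r : ℝ) (n m : Fin 3 → ℝ) {v : Fin 3 → ℝ} (hv : v ⬝ᵥ v = 1) :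
    v ⬝ᵥ (biax s r n m).mulVec v
      = s * ((n ⬝ᵥ v) ^ 2 + r * (m ⬝ᵥ v) ^ 2 - (1 + r) / 3) := by
  have h : v ⬝ᵥ (biax s r n m).mulVec v
      = s * ((n ⬝ᵥ v) ^ 2 + r * (m ⬝ᵥ v) ^ 2 - (1 + r) / 3 * (v ⬝ᵥ v)) := by
    simp [biax, Matrix.mulVec, dotProduct, Fin.sum_univ_three, outer, Matrix.one_apply]
    ring
  rw [h, hv, mul_one]

lemma lam1_biax {s r : ℝ} {n m : Fin 3 → ℝ} (hs : 0 ≤ s) (hr1 : r ≤ 1)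
    (hn : n ⬝ᵥ n = 1) (hm : m ⬝ᵥ m = 1) (hnm : n ⬝ᵥ m = 0) :
    lam1 (biax s r n m) = s * (2 - r) / 3 := by
  refine IsGreatest.csSup_eq ⟨⟨n, hn, ?_⟩, ?_⟩
  · rw [dotProduct_biax_mulVec s r n m hn, hn, dotProduct_comm m n, hnm]
    ring
  · rintro x ⟨v, hv, rfl⟩
    rw [dotProduct_biax_mulVec s r n m hv]
    have := mul_le_mul_of_nonneg_left
      (sq_dotProduct_add_mul_sq_dotProduct_le_one hr1 hn hm hnm hv) hs
    linarith

lemma lam3_biax {s r : ℝ} {n m : Fin 3 → ℝ} (hs : 0 ≤ s) (hr0 : 0 ≤ r)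
    (hn : n ⬝ᵥ n = 1) (hm : m ⬝ᵥ m = 1) (hnm : n ⬝ᵥ m = 0) :
    lam3 (biax s r n m) = -(s * (1 + r) / 3) := by
  have hv : (n ⨯₃ m) ⬝ᵥ (n ⨯₃ m) = 1 := by
    rw [cross_dot_cross, hn, hm, hnm]
    norm_num
  refine IsLeast.csInf_eq ⟨⟨n ⨯₃ m, hv, ?_⟩, ?_⟩
  · rw [dotProduct_biax_mulVec s r n m hv, dot_self_cross, dot_cross_self]
    ring
  · rintro x ⟨v, hv, rfl⟩
    rw [dotProduct_biax_mulVec s r n m hv]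
    have : 0 ≤ s * ((n ⬝ᵥ v) ^ 2 + r * (m ⬝ᵥ v) ^ 2) := by positivity
    linarith

lemma trace_biax (s r : ℝ) {n m : Fin 3 → ℝ} (hn : n ⬝ᵥ n = 1) (hm : m ⬝ᵥ m = 1) :
    (biax s r n m).trace = 0 := by
  have h : (biax s r n m).trace = s * ((n ⬝ᵥ n - 1) + r * (m ⬝ᵥ m - 1)) := by
    simp [biax, Matrix.trace, dotProduct, Fin.sum_univ_three, outer]
    ring
  rw [h, hn, hm]
  ring

lemma lam1_sub_lam2_biax {s r : ℝ} {n m : Fin 3 → ℝ} (hs : 0 ≤ s) (hr0 : 0 ≤ r) (hr1 : r ≤ 1)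
    (hn : n ⬝ᵥ n = 1) (hm : m ⬝ᵥ m = 1) (hnm : n ⬝ᵥ m = 0) :
    lam1 (biax s r n m) - lam2 (biax s r n m) = s - s * r := by
  rw [lam2, trace_biax s r hn hm, lam1_biax hs hr1 hn hm hnm, lam3_biax hs hr0 hn hm hnm]
  ring

lemma le_trace_sq_biax_sub_uniax {s r S : ℝ} {n m p : Fin 3 → ℝ} (hs : 0 ≤ s) (hr1 : r ≤ 1)
    (hS : 0 ≤ S) (hn : n ⬝ᵥ n = 1) (hm : m ⬝ᵥ m = 1) (hnm : n ⬝ᵥ m = 0) (hp : p ⬝ᵥ p = 1) :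
    2 / 3 * ((s - S) ^ 2 - (s - S) * (s * r) + (s * r) ^ 2)
      ≤ ((biax s r n m - uniax S p) * (biax s r n m - uniax S p)).trace := by
  rw [trace_sq_outer_combination n m p s (s * r) (-S) ((S - s - s * r) / 3) _
    (by rw [biax, uniax]; module), hn, hm, hnm, hp]
  have := mul_le_mul_of_nonneg_left
    (sq_dotProduct_add_mul_sq_dotProduct_le_one hr1 hn hm hnm hp) (mul_nonneg hs hS)
  linarith

lemma sstar_pos {a b c : ℝ} (hb : 0 < b) (hc : 0 < c) : 0 < sstar a b c := by
  unfold sstar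
  positivity

lemma sqrt_le_distN_biax {a b c s r : ℝ} {n m : Fin 3 → ℝ} (hb : 0 < b) (hc : 0 < c)
    (hs : 0 ≤ s) (hr1 : r ≤ 1) (hn : n ⬝ᵥ n = 1) (hm : m ⬝ᵥ m = 1) (hnm : n ⬝ᵥ m = 0) :
    √(2 / 3 * ((s - sstar a b c) ^ 2 - (s - sstar a b c) * (s * r) + (s * r) ^ 2))
      ≤ distN a b c (biax s r n m) := by
  refine le_csInf (Set.Nonempty.image _ ⟨_, ![1, 0, 0], by simp [unitVec], rfl⟩) ?_
  rintro _ ⟨_, ⟨p, hp, rfl⟩, rfl⟩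
  refine Real.sqrt_le_sqrt (le_trace_sq_biax_sub_uniax hs hr1 (sstar_pos hb hc).le hn hm hnm ?_)
  rw [← hp]
  simp [dotProduct, Fin.sum_univ_three, sq]

/-- If `Q ∈ Sym₀` satisfies `dist(Q, N) ≤ δ` and is written as
`Q = s((n⊗n - Id/3) + r(m⊗m - Id/3))` with `s ≥ 0`, `r ∈ [0,1]` and `n, m` orthonormal
eigenvectors of `Q`, then `|s - s*| ≤ √3 δ`, `s r ≤ √3 δ`, and consequently
`1 - (2√3/s*) δ ≤ φ(Q) ≤ 1 + (2√3/s*) δ`, where `φ(Q) = (λ₁(Q) - λ₂(Q))/s*`. -/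
theorem statement10 (a b c : ℝ) (ha : 0 < a) (hb : 0 < b) (hc : 0 < c)
    (δ : ℝ) (hδ : 0 ≤ δ)
    (Q : Matrix (Fin 3) (Fin 3) ℝ) (hQ : Q ∈ Sym0) (hdist : distN a b c Q ≤ δ)
    (s r : ℝ) (n m : Fin 3 → ℝ)
    (hs : 0 ≤ s) (hr0 : 0 ≤ r) (hr1 : r ≤ 1)
    (hn : n ⬝ᵥ n = 1) (hm : m ⬝ᵥ m = 1) (hnm : n ⬝ᵥ m = 0)
    (heign : ∃ μ : ℝ, Q.mulVec n = μ • n) (heigm : ∃ μ : ℝ, Q.mulVec m = μ • m)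
    (hdecomp : Q = s • ((outer n - (1 / 3 : ℝ) • (1 : Matrix (Fin 3) (Fin 3) ℝ)) +
        r • (outer m - (1 / 3 : ℝ) • (1 : Matrix (Fin 3) (Fin 3) ℝ)))) :
    |s - sstar a b c| ≤ Real.sqrt 3 * δ ∧
    s * r ≤ Real.sqrt 3 * δ ∧
    1 - (2 * Real.sqrt 3 / sstar a b c) * δ ≤ (lam1 Q - lam2 Q) / sstar a b c ∧
    (lam1 Q - lam2 Q) / sstar a b c ≤ 1 + (2 * Real.sqrt 3 / sstar a b c) * δ := by
  obtain rfl : Q = biax s r n m := hdecomp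
  have hS := sstar_pos (a := a) hb hc
  rw [lam1_sub_lam2_biax hs hr0 hr1 hn hm hnm]
  have hD := (Real.sqrt_le_left hδ).1 ((sqrt_le_distN_biax hb hc hs hr1 hn hm hnm).trans hdist)
  set S := sstar a b c
  have hδ3 : 0 ≤ √3 * δ := by positivity
  have hsq : (√3 * δ) ^ 2 = 3 * δ ^ 2 := by rw [mul_pow, Real.sq_sqrt (by norm_num)]
  have hsS : |s - S| ≤ √3 * δ := by
    apply abs_le_of_sq_le_sq _ hδ3
    nlinarith [sq_nonneg (s - S - s * r), sq_nonneg (s * r)]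
  have hsr : s * r ≤ √3 * δ := by
    apply le_of_sq_le_sq _ hδ3
    nlinarith [sq_nonneg (s - S - s * r), sq_nonneg (s - S)]
  have hsr0 : 0 ≤ s * r := mul_nonneg hs hr0
  obtain ⟨h1, h2⟩ := abs_le.1 hsS
  refine ⟨hsS, hsr, ?_, ?_⟩
  · rw [le_div_iff₀ hS, sub_mul, mul_right_comm, div_mul_cancel₀ _ hS.ne']
    linarith
  · rw [div_le_iff₀ hS, add_mul, mul_right_comm, div_mul_cancel₀ _ hS.ne']
    linarith

end
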